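/- Let K be a field, V a K-vector space, and let v : Fin r → V and w : Fin s → V both be linearly independent families with r, s ≥ 1. Then the product (ι(v 0) * ... * ι(v (r-1))) * (ι(w 0) * ... * ι(w (s-1))) equals 0 in the exterior algebra if and only if the subspaces span K (range v) and span K (range w) have nontrivial intersection (their infimum as submodules is not ⊥). -/

import Mathlib

/-- An alternating product of vectors over a field vanishes iff they are linearly dependent. -/
theorem ExteriorAlgebra.ιMulti_eq_zero_iff {K V : Type*} [Field K] [AddCommGroup V] [Module K V]
    {n : ℕ} (u : Fin n → V) : ExteriorAlgebra.ιMulti K n u = 0 ↔ ¬ LinearIndependent K u := by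
  refine ⟨fun h hu => ?_, fun h => AlternatingMap.map_linearDependent _ u h⟩
  let b := Module.Basis.span hu
  obtain ⟨f, hf⟩ := LinearMap.exists_extend b.equivFun.toLinearMap
  have hfu (i : Fin n) : f (u i) = Pi.single i 1 := by
    have := LinearMap.congr_fun hf (b i)
    have hb : (b i : V) = u i := congrArg Subtype.val (Module.Basis.span_apply hu i)
    rw [LinearMap.comp_apply, Submodule.subtype_apply, hb] at this
    rw [this]
    ext j
    simp [Pi.single_apply, eq_comm]
  let D : V [⋀^Fin n]→ₗ[K] K := Matrix.detRowAlternating.compLinearMap f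
  have hD : D u = 1 := by
    have : (fun i => f (u i)) = (1 : Matrix (Fin n) (Fin n) K) := by
      ext i j
      rw [hfu, Matrix.one_apply, Pi.single_apply]
      simp only [eq_comm]
    change Matrix.det (fun i => f (u i)) = 1
    rw [this, Matrix.det_one]
  have key := ExteriorAlgebra.liftAlternating_apply_ιMulti (R := K) (Pi.single n D) u
  rw [h, map_zero, Pi.single_eq_same, hD] at key
  exact zero_ne_one key

theorem Fin.append_comp_finSumFinEquiv {α : Type*} {m n : ℕ} (v : Fin m → α) (w : Fin n → α) :
    Fin.append v w ∘ finSumFinEquiv = Sum.elim v w := by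
  ext (i | i) <;> simp

theorem blade_mul_blade_eq_zero_iff_inf_ne_bot
    (K : Type*) [Field K] (V : Type*) [AddCommGroup V] [Module K V]
    (r s : ℕ) (hr : 1 ≤ r) (hs : 1 ≤ s) (v : Fin r → V) (w : Fin s → V)
    (hv : LinearIndependent K v) (hw : LinearIndependent K w) :
    (List.ofFn fun i => ExteriorAlgebra.ι K (v i)).prod *
        (List.ofFn fun i => ExteriorAlgebra.ι K (w i)).prod = 0 ↔
      Submodule.span K (Set.range v) ⊓ Submodule.span K (Set.range w) ≠ ⊥ := by
  rw [← ExteriorAlgebra.ιMulti_apply, ← ExteriorAlgebra.ιMulti_apply,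
    ExteriorAlgebra.ιMulti_mul_ιMulti, ExteriorAlgebra.ιMulti_eq_zero_iff, ne_eq, not_iff_not,
    ← linearIndependent_equiv finSumFinEquiv, Fin.append_comp_finSumFinEquiv, linearIndependent_sum]
  simp [hv, hw, disjoint_iff, Function.comp_def]
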